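/- arXiv:math/0008235 — 2 statements merged into one kernel-verified Lean document; each statement's English description precedes it below -/
import Mathlib

section
/- (Tietze equivalence of the two presentations of B_{m,n}) Let G₂ be the presented group on generators x_{ij} (1 ≤ i ≤ m, m+1 ≤ j ≤ m+n) and s_k (m+1 ≤ k ≤ m+n−1) subject to relations Σ1, Σ2 and (1)–(4) of Theorem 2, and let G₃ be the presented group on generators y_1, …, y_m and t_1, …, t_{n−1} subject to the relations t_k t_l = t_l t_k for |k−l| > 1; t_k t_{k+1} t_k = t_{k+1} t_k t_{k+1}; y_i t_k = t_k y_i for k ≥ 2; y_i t_1 y_i t_1 = t_1 y_i t_1 y_i; and y_i (t_1 y_r t_1⁻¹) = (t_1 y_r t_1⁻¹) y_i for r < i. Then there is a group isomorphism G₂ ≅ G₃ sending x_{i,m+1} to y_i and s_{m+k} to t_k. -/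
open FreeGroup

namespace BraidPaper

/-- Relators for the Artin braid group on generators `σ_1, …, σ_n`
(so this presents the braid group `B_{n+1}`); the generator with index `k : Fin n`
represents `σ_{k+1}`. -/
def braidRels (n : ℕ) : Set (FreeGroup (Fin n)) :=
  {x | ∃ k l : Fin n, ((k : ℕ) + 2 ≤ (l : ℕ) ∨ (l : ℕ) + 2 ≤ (k : ℕ)) ∧
      x = of k * of l * (of k)⁻¹ * (of l)⁻¹} ∪
  {x | ∃ k l : Fin n, (l : ℕ) = (k : ℕ) + 1 ∧
      x = of k * of l * of k * (of l)⁻¹ * (of k)⁻¹ * (of l)⁻¹}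

/-- The braid group with `n` generators `σ_1, …, σ_n`, i.e. the Artin braid group
`B_{n+1}`.  Thus `B_N = BraidGroup (N-1)`. -/
abbrev BraidGroup (n : ℕ) : Type := PresentedGroup (braidRels n)

/-- The generator `σ_k` (1-based) of `BraidGroup n`, for `1 ≤ k ≤ n`. -/
def sgen (n k : ℕ) : BraidGroup n :=
  if h : 1 ≤ k ∧ k ≤ n then PresentedGroup.of ⟨k - 1, by omega⟩ else 1

/-- The descending product `σ_{j-1} σ_{j-2} ⋯ σ_{i+1}`. -/
def dprod (n i j : ℕ) : BraidGroup n :=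
  ((List.range (j - 1 - i)).map fun t => sgen n (j - 1 - t)).prod

/-- The pure braid generator
`a_{ij} = σ_{j-1} σ_{j-2} ⋯ σ_{i+1} σ_i² σ_{i+1}⁻¹ ⋯ σ_{j-2}⁻¹ σ_{j-1}⁻¹`. -/
def agen (n i j : ℕ) : BraidGroup n := dprod n i j * (sgen n i) ^ 2 * (dprod n i j)⁻¹
/-- The generating set of the mixed braid group `B_{m,n} ≤ B_{m+n}`:
the pure generators `a_{ij}` with `1 ≤ i < j`, `m+1 ≤ j ≤ m+n`, together with
the crossings `σ_{m+1}, …, σ_{m+n-1}` among the last `n` strands. -/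
def BmnSet (m n : ℕ) : Set (BraidGroup (m + n - 1)) :=
  {x | ∃ i j : ℕ, 1 ≤ i ∧ i < j ∧ m + 1 ≤ j ∧ j ≤ m + n ∧ x = agen (m + n - 1) i j} ∪
  {x | ∃ k : ℕ, m + 1 ≤ k ∧ k ≤ m + n - 1 ∧ x = sgen (m + n - 1) k}

/-- The mixed braid group `B_{m,n}`, as a subgroup of `B_{m+n}`. -/
def Bmn (m n : ℕ) : Subgroup (BraidGroup (m + n - 1)) := Subgroup.closure (BmnSet m n)
/-- Index set for the presentation of Theorem 2: generators `x_{ij}`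
(`1 ≤ i ≤ m`, `m+1 ≤ j ≤ m+n`) and `s_k` (`m+1 ≤ k ≤ m+n−1`). -/
def MixedIdx (m n : ℕ) : Type :=
  {p : ℕ × ℕ // 1 ≤ p.1 ∧ p.1 ≤ m ∧ m + 1 ≤ p.2 ∧ p.2 ≤ m + n} ⊕
    {k : ℕ // m + 1 ≤ k ∧ k ≤ m + n - 1}

/-- The relators Σ1, Σ2, (1), (2), (3), (4) of Theorem 2, as words in the free group
on `MixedIdx m n`. -/
def mixedRels (m n : ℕ) : Set (FreeGroup (MixedIdx m n)) :=
  -- (Σ1)  s_k s_l = s_l s_k  for |k−l| > 1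
  {x | ∃ k l : {k : ℕ // m + 1 ≤ k ∧ k ≤ m + n - 1}, (k.1 + 1 < l.1 ∨ l.1 + 1 < k.1) ∧
      x = of (Sum.inr k) * of (Sum.inr l) * (of (Sum.inr k))⁻¹ * (of (Sum.inr l))⁻¹} ∪
  -- (Σ2)  s_k s_{k+1} s_k = s_{k+1} s_k s_{k+1}
  {x | ∃ k : ℕ, ∃ _h : m + 1 ≤ k ∧ k + 1 ≤ m + n - 1,
      x = of (Sum.inr ⟨k, by omega⟩) * of (Sum.inr ⟨k + 1, by omega⟩) *
            of (Sum.inr ⟨k, by omega⟩) *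
          (of (Sum.inr ⟨k + 1, by omega⟩) * of (Sum.inr ⟨k, by omega⟩) *
            of (Sum.inr ⟨k + 1, by omega⟩))⁻¹} ∪
  -- (1)  s_k⁻¹ x_{ij} s_k = x_{ij}  for  k ≤ j−2  or  k ≥ j+1
  {x | ∃ i j k : ℕ, ∃ _h : (1 ≤ i ∧ i ≤ m ∧ m + 1 ≤ j ∧ j ≤ m + n ∧
        m + 1 ≤ k ∧ k ≤ m + n - 1) ∧ (k + 2 ≤ j ∨ j + 1 ≤ k),
      x = (of (Sum.inr ⟨k, by omega⟩))⁻¹ * of (Sum.inl ⟨(i, j), by omega⟩) *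
            of (Sum.inr ⟨k, by omega⟩) * (of (Sum.inl ⟨(i, j), by omega⟩))⁻¹} ∪
  -- (2)  x_{ij} = s_{j−1} x_{i,j−1} s_{j−1}⁻¹  for  j ≥ m+2
  {x | ∃ i j : ℕ, ∃ _h : 1 ≤ i ∧ i ≤ m ∧ m + 2 ≤ j ∧ j ≤ m + n,
      x = of (Sum.inl ⟨(i, j), by omega⟩) *
          (of (Sum.inr ⟨j - 1, by omega⟩) * of (Sum.inl ⟨(i, j - 1), by omega⟩) *
            (of (Sum.inr ⟨j - 1, by omega⟩))⁻¹)⁻¹} ∪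
  -- (3)  s_j⁻¹ x_{ij} s_j = x_{ij} x_{i,j+1} x_{ij}⁻¹  for  j ≤ m+n−1
  {x | ∃ i j : ℕ, ∃ _h : 1 ≤ i ∧ i ≤ m ∧ m + 1 ≤ j ∧ j ≤ m + n - 1,
      x = (of (Sum.inr ⟨j, by omega⟩))⁻¹ * of (Sum.inl ⟨(i, j), by omega⟩) *
            of (Sum.inr ⟨j, by omega⟩) *
          (of (Sum.inl ⟨(i, j), by omega⟩) * of (Sum.inl ⟨(i, j + 1), by omega⟩) *
            (of (Sum.inl ⟨(i, j), by omega⟩))⁻¹)⁻¹} ∪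
  -- (4)  x_{ij} x_{r,j+1} = x_{r,j+1} x_{ij}  for  r < i ≤ m  and  j ≤ m+n−1
  {x | ∃ i r j : ℕ, ∃ _h : 1 ≤ r ∧ r < i ∧ i ≤ m ∧ m + 1 ≤ j ∧ j ≤ m + n - 1,
      x = of (Sum.inl ⟨(i, j), by omega⟩) * of (Sum.inl ⟨(r, j + 1), by omega⟩) *
          (of (Sum.inl ⟨(r, j + 1), by omega⟩) * of (Sum.inl ⟨(i, j), by omega⟩))⁻¹}
/-- Index set for the irredundant presentation of Theorem 3: generators
`y_1, …, y_m` and `t_1, …, t_{n−1}`. -/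
def IrrIdx (m n : ℕ) : Type :=
  {i : ℕ // 1 ≤ i ∧ i ≤ m} ⊕ {k : ℕ // 1 ≤ k ∧ k ≤ n - 1}

/-- The relators of the irredundant presentation of Theorem 3, as words in the
free group on `IrrIdx m n`. -/
def irrRels (m n : ℕ) : Set (FreeGroup (IrrIdx m n)) :=
  -- t_k t_l = t_l t_k  for |k−l| > 1
  {x | ∃ k l : {k : ℕ // 1 ≤ k ∧ k ≤ n - 1}, (k.1 + 1 < l.1 ∨ l.1 + 1 < k.1) ∧
      x = of (Sum.inr k) * of (Sum.inr l) * (of (Sum.inr k))⁻¹ * (of (Sum.inr l))⁻¹} ∪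
  -- t_k t_{k+1} t_k = t_{k+1} t_k t_{k+1}  for 1 ≤ k ≤ n−2
  {x | ∃ k : ℕ, ∃ _h : 1 ≤ k ∧ k + 1 ≤ n - 1,
      x = of (Sum.inr ⟨k, by omega⟩) * of (Sum.inr ⟨k + 1, by omega⟩) *
            of (Sum.inr ⟨k, by omega⟩) *
          (of (Sum.inr ⟨k + 1, by omega⟩) * of (Sum.inr ⟨k, by omega⟩) *
            of (Sum.inr ⟨k + 1, by omega⟩))⁻¹} ∪
  -- y_i t_k = t_k y_i  for k ≥ 2, 1 ≤ i ≤ m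
  {x | ∃ i k : ℕ, ∃ _h : 1 ≤ i ∧ i ≤ m ∧ 2 ≤ k ∧ k ≤ n - 1,
      x = of (Sum.inl ⟨i, by omega⟩) * of (Sum.inr ⟨k, by omega⟩) *
          (of (Sum.inr ⟨k, by omega⟩) * of (Sum.inl ⟨i, by omega⟩))⁻¹} ∪
  -- y_i t_1 y_i t_1 = t_1 y_i t_1 y_i  for 1 ≤ i ≤ m
  {x | ∃ i : ℕ, ∃ _h : 1 ≤ i ∧ i ≤ m ∧ 1 ≤ n - 1,
      x = of (Sum.inl ⟨i, by omega⟩) * of (Sum.inr ⟨1, by omega⟩) *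
            of (Sum.inl ⟨i, by omega⟩) * of (Sum.inr ⟨1, by omega⟩) *
          (of (Sum.inr ⟨1, by omega⟩) * of (Sum.inl ⟨i, by omega⟩) *
            of (Sum.inr ⟨1, by omega⟩) * of (Sum.inl ⟨i, by omega⟩))⁻¹} ∪
  -- y_i (t_1 y_r t_1⁻¹) = (t_1 y_r t_1⁻¹) y_i  for 1 ≤ r < i ≤ m
  {x | ∃ i r : ℕ, ∃ _h : 1 ≤ r ∧ r < i ∧ i ≤ m ∧ 1 ≤ n - 1,
      x = of (Sum.inl ⟨i, by omega⟩) *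
            (of (Sum.inr ⟨1, by omega⟩) * of (Sum.inl ⟨r, by omega⟩) *
              (of (Sum.inr ⟨1, by omega⟩))⁻¹) *
          (of (Sum.inr ⟨1, by omega⟩) * of (Sum.inl ⟨r, by omega⟩) *
              (of (Sum.inr ⟨1, by omega⟩))⁻¹ * of (Sum.inl ⟨i, by omega⟩))⁻¹}

section ConjTower

variable {G : Type*} [Group G]

/-- The iterated conjugate `t_p ⋯ t_1 y t_1⁻¹ ⋯ t_p⁻¹`. -/
def conjTower (t : ℕ → G) (y : G) : ℕ → G
  | 0 => y
  | p + 1 => t (p + 1) * conjTower t y p * (t (p + 1))⁻¹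

theorem conjTower_succ (t : ℕ → G) (y : G) (p : ℕ) :
    conjTower t y (p + 1) = t (p + 1) * conjTower t y p * (t (p + 1))⁻¹ := rfl

theorem semiconjBy_conjTower_succ (t : ℕ → G) (y : G) (p : ℕ) :
    SemiconjBy (t (p + 1)) (conjTower t y p) (conjTower t y (p + 1)) :=
  SemiconjBy.conj_mk _ _

theorem semiconjBy_of_braid {a b : G} (h : a * b * a = b * a * b) : SemiconjBy (a * b) a b := by
  rw [SemiconjBy, h, mul_assoc]

theorem commute_of_semiconjBy {g a a' b b' : G} (h : Commute a a') (hb : SemiconjBy g a b)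
    (hb' : SemiconjBy g a' b') : Commute b b' := by
  have h₁ := hb.mul_right hb'
  have h₂ := hb'.mul_right hb
  rw [h.eq] at h₁
  exact mul_right_cancel (h₁.eq.symm.trans h₂.eq)

variable {N : ℕ} {t : ℕ → G} {y : G}

theorem commute_conjTower_of_lt
    (hcomm : ∀ k l, 1 ≤ k → k + 1 < l → l ≤ N → Commute (t k) (t l))
    (hy : ∀ k, 2 ≤ k → k ≤ N → Commute y (t k)) {p k : ℕ} (hpk : p + 2 ≤ k) (hk : k ≤ N) :
    Commute (conjTower t y p) (t k) := by
  induction p with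
  | zero => exact hy k hpk hk
  | succ p ih =>
    have h := hcomm (p + 1) k (by omega) (by omega) hk
    exact (h.mul_left (ih (by omega))).mul_left h.inv_left

theorem semiconjBy_mul_conjTower
    (hcomm : ∀ k l, 1 ≤ k → k + 1 < l → l ≤ N → Commute (t k) (t l))
    (hy : ∀ k, 2 ≤ k → k ≤ N → Commute y (t k)) {p : ℕ} (hp : p + 2 ≤ N) :
    SemiconjBy (t (p + 1) * t (p + 2)) (conjTower t y p) (conjTower t y (p + 1)) :=
  (semiconjBy_conjTower_succ t y p).mul_left
    (commute_conjTower_of_lt hcomm hy le_rfl hp).symm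

theorem semiconjBy_mul_conjTower_succ
    (hcomm : ∀ k l, 1 ≤ k → k + 1 < l → l ≤ N → Commute (t k) (t l))
    (hbraid : ∀ k, 1 ≤ k → k + 1 ≤ N → t k * t (k + 1) * t k = t (k + 1) * t k * t (k + 1))
    (hy : ∀ k, 2 ≤ k → k ≤ N → Commute y (t k)) {p : ℕ} (hp : p + 2 ≤ N) :
    SemiconjBy (t (p + 1) * t (p + 2)) (conjTower t y (p + 1)) (conjTower t y (p + 2)) := by
  have h := semiconjBy_of_braid (hbraid (p + 1) (by omega) hp)
  exact (h.mul_right (semiconjBy_mul_conjTower hcomm hy hp)).mul_right h.inv_right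

theorem commute_conjTower_of_gt
    (hcomm : ∀ k l, 1 ≤ k → k + 1 < l → l ≤ N → Commute (t k) (t l))
    (hbraid : ∀ k, 1 ≤ k → k + 1 ≤ N → t k * t (k + 1) * t k = t (k + 1) * t k * t (k + 1))
    (hy : ∀ k, 2 ≤ k → k ≤ N → Commute y (t k)) {p k : ℕ} (hk : 1 ≤ k) (hkp : k + 1 ≤ p)
    (hp : p ≤ N) : Commute (conjTower t y p) (t k) := by
  induction p, hkp using Nat.le_induction with
  | base =>
    obtain ⟨q, rfl⟩ := Nat.exists_eq_add_of_le' hk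
    have hc := commute_conjTower_of_lt hcomm hy (le_refl (q + 2)) hp
    have h₁ : SemiconjBy (t (q + 2) * t (q + 1)) (t (q + 2)) (t (q + 1)) :=
      semiconjBy_of_braid (hbraid (q + 1) hk hp).symm
    have h₂ : SemiconjBy (t (q + 2) * t (q + 1)) (conjTower t y q) (conjTower t y (q + 2)) :=
      (semiconjBy_conjTower_succ t y (q + 1)).mul_left (semiconjBy_conjTower_succ t y q)
    exact commute_of_semiconjBy hc h₂ h₁
  | succ p hkp ih =>
    have h := (hcomm k (p + 1) hk (by omega) hp).symm
    exact (h.mul_left (ih (by omega))).mul_left h.inv_left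

theorem commute_conjTower_mul_conjTower_mul
    (hcomm : ∀ k l, 1 ≤ k → k + 1 < l → l ≤ N → Commute (t k) (t l))
    (hbraid : ∀ k, 1 ≤ k → k + 1 ≤ N → t k * t (k + 1) * t k = t (k + 1) * t k * t (k + 1))
    (hy : ∀ k, 2 ≤ k → k ≤ N → Commute y (t k))
    (hy₁ : 1 ≤ N → Commute y (t 1 * y * t 1)) {p : ℕ} (hp : p + 1 ≤ N) :
    Commute (conjTower t y p) (t (p + 1) * conjTower t y p * t (p + 1)) := by
  induction p with
  | zero => exact hy₁ hp
  | succ p ih =>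
    have ht := semiconjBy_of_braid (hbraid (p + 1) (by omega) hp)
    have hx := semiconjBy_mul_conjTower hcomm hy hp
    exact commute_of_semiconjBy (ih (by omega)) hx
      ((ht.mul_right hx).mul_right ht)

theorem commute_conjTower_conjTower_succ {z : G}
    (hcomm : ∀ k l, 1 ≤ k → k + 1 < l → l ≤ N → Commute (t k) (t l))
    (hbraid : ∀ k, 1 ≤ k → k + 1 ≤ N → t k * t (k + 1) * t k = t (k + 1) * t k * t (k + 1))
    (hy : ∀ k, 2 ≤ k → k ≤ N → Commute y (t k))
    (hz : ∀ k, 2 ≤ k → k ≤ N → Commute z (t k))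
    (hyz : 1 ≤ N → Commute y (t 1 * z * (t 1)⁻¹)) {p : ℕ} (hp : p + 1 ≤ N) :
    Commute (conjTower t y p) (conjTower t z (p + 1)) := by
  induction p with
  | zero => exact hyz hp
  | succ p ih =>
    exact commute_of_semiconjBy (ih (by omega)) (semiconjBy_mul_conjTower hcomm hy hp)
      (semiconjBy_mul_conjTower_succ hcomm hbraid hz hp)

theorem inv_conj_eq_iff_commute {a x : G} :
    a⁻¹ * x * a = x * (a * x * a⁻¹) * x⁻¹ ↔ Commute x (a * x * a) := by
  rw [eq_mul_inv_iff_mul_eq, ← mul_assoc x, eq_mul_inv_iff_mul_eq,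
    show a⁻¹ * x * a * x * a = a⁻¹ * (x * a * x * a) by group, inv_mul_eq_iff_eq_mul,
    commute_iff_eq]
  simp only [mul_assoc]

end ConjTower

section Irredundant

variable (m n : ℕ)

/-- The generator `y_i`, extended by `1` outside its range. -/
def irrY (i : ℕ) : PresentedGroup (irrRels m n) :=
  if h : 1 ≤ i ∧ i ≤ m then PresentedGroup.of (α := IrrIdx m n) (Sum.inl ⟨i, h⟩) else 1

/-- The generator `t_k`, extended by `1` outside its range. -/
def irrT (k : ℕ) : PresentedGroup (irrRels m n) :=
  if h : 1 ≤ k ∧ k ≤ n - 1 then PresentedGroup.of (α := IrrIdx m n) (Sum.inr ⟨k, h⟩) else 1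

variable {m n}

theorem irrY_of_mem {i : ℕ} (h : 1 ≤ i ∧ i ≤ m) :
    irrY m n i = PresentedGroup.mk (irrRels m n) (of (Sum.inl ⟨i, h⟩)) := dif_pos h

theorem irrT_of_mem {k : ℕ} (h : 1 ≤ k ∧ k ≤ n - 1) :
    irrT m n k = PresentedGroup.mk (irrRels m n) (of (Sum.inr ⟨k, h⟩)) := dif_pos h

theorem commute_irrT (k l : ℕ) (hk : 1 ≤ k) (hkl : k + 1 < l) (hl : l ≤ n - 1) :
    Commute (irrT m n k) (irrT m n l) := by
  rw [← commutatorElement_eq_one_iff_commute, irrT_of_mem ⟨hk, by omega⟩,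
    irrT_of_mem ⟨by omega, hl⟩]
  exact PresentedGroup.one_of_mem
    (Or.inl (Or.inl (Or.inl (Or.inl ⟨⟨k, _⟩, ⟨l, _⟩, Or.inl hkl, rfl⟩))))

theorem irrT_braid (k : ℕ) (hk : 1 ≤ k) (hkn : k + 1 ≤ n - 1) :
    irrT m n k * irrT m n (k + 1) * irrT m n k =
      irrT m n (k + 1) * irrT m n k * irrT m n (k + 1) := by
  rw [← mul_inv_eq_one, irrT_of_mem ⟨hk, by omega⟩, irrT_of_mem ⟨by omega, hkn⟩]
  exact PresentedGroup.one_of_mem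
    (Or.inl (Or.inl (Or.inl (Or.inr ⟨k, ⟨hk, hkn⟩, rfl⟩))))

theorem commute_irrY_irrT {i : ℕ} (hi : 1 ≤ i ∧ i ≤ m) (k : ℕ) (hk : 2 ≤ k) (hkn : k ≤ n - 1) :
    Commute (irrY m n i) (irrT m n k) := by
  rw [commute_iff_eq, ← mul_inv_eq_one, irrY_of_mem hi, irrT_of_mem ⟨by omega, hkn⟩]
  exact PresentedGroup.one_of_mem
    (Or.inl (Or.inl (Or.inr ⟨i, k, ⟨hi.1, hi.2, hk, hkn⟩, rfl⟩)))

theorem commute_irrY_mul {i : ℕ} (hi : 1 ≤ i ∧ i ≤ m) (hn : 1 ≤ n - 1) :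
    Commute (irrY m n i) (irrT m n 1 * irrY m n i * irrT m n 1) := by
  rw [commute_iff_eq, ← mul_inv_eq_one, ← mul_assoc, ← mul_assoc, irrY_of_mem hi,
    irrT_of_mem ⟨le_rfl, hn⟩]
  exact PresentedGroup.one_of_mem (Or.inl (Or.inr ⟨i, ⟨hi.1, hi.2, hn⟩, rfl⟩))

theorem commute_irrY_conj {i r : ℕ} (hr : 1 ≤ r) (hri : r < i) (hi : i ≤ m) (hn : 1 ≤ n - 1) :
    Commute (irrY m n i) (irrT m n 1 * irrY m n r * (irrT m n 1)⁻¹) := by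
  rw [commute_iff_eq, ← mul_inv_eq_one, irrY_of_mem ⟨by omega, hi⟩, irrY_of_mem ⟨hr, by omega⟩,
    irrT_of_mem ⟨le_rfl, hn⟩]
  exact PresentedGroup.one_of_mem (Or.inr ⟨i, r, ⟨hr, hri, hi, hn⟩, rfl⟩)

end Irredundant

section Mixed

variable (m n : ℕ)

/-- The generator `x_{ij}`, extended by `1` outside its range. -/
def mixedX (i j : ℕ) : PresentedGroup (mixedRels m n) :=
  if h : 1 ≤ i ∧ i ≤ m ∧ m + 1 ≤ j ∧ j ≤ m + n then
    PresentedGroup.of (α := MixedIdx m n) (Sum.inl ⟨(i, j), h⟩) else 1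

/-- The generator `s_k`, extended by `1` outside its range. -/
def mixedS (k : ℕ) : PresentedGroup (mixedRels m n) :=
  if h : m + 1 ≤ k ∧ k ≤ m + n - 1 then
    PresentedGroup.of (α := MixedIdx m n) (Sum.inr ⟨k, h⟩) else 1

variable {m n}

theorem mixedX_of_mem {i j : ℕ} (h : 1 ≤ i ∧ i ≤ m ∧ m + 1 ≤ j ∧ j ≤ m + n) :
    mixedX m n i j = PresentedGroup.mk (mixedRels m n) (of (Sum.inl ⟨(i, j), h⟩)) := dif_pos h

theorem mixedS_of_mem {k : ℕ} (h : m + 1 ≤ k ∧ k ≤ m + n - 1) :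
    mixedS m n k = PresentedGroup.mk (mixedRels m n) (of (Sum.inr ⟨k, h⟩)) := dif_pos h

theorem commute_mixedS {k l : ℕ} (hk : m + 1 ≤ k ∧ k ≤ m + n - 1)
    (hl : m + 1 ≤ l ∧ l ≤ m + n - 1) (hkl : k + 1 < l ∨ l + 1 < k) :
    Commute (mixedS m n k) (mixedS m n l) := by
  rw [← commutatorElement_eq_one_iff_commute, mixedS_of_mem hk, mixedS_of_mem hl]
  exact PresentedGroup.one_of_mem
    (Or.inl (Or.inl (Or.inl (Or.inl (Or.inl ⟨⟨k, hk⟩, ⟨l, hl⟩, hkl, rfl⟩)))))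

theorem mixedS_braid {k : ℕ} (hk : m + 1 ≤ k) (hkn : k + 1 ≤ m + n - 1) :
    mixedS m n k * mixedS m n (k + 1) * mixedS m n k =
      mixedS m n (k + 1) * mixedS m n k * mixedS m n (k + 1) := by
  rw [← mul_inv_eq_one, mixedS_of_mem ⟨hk, by omega⟩, mixedS_of_mem ⟨by omega, hkn⟩]
  exact PresentedGroup.one_of_mem
    (Or.inl (Or.inl (Or.inl (Or.inl (Or.inr ⟨k, ⟨hk, hkn⟩, rfl⟩)))))

theorem commute_mixedX_mixedS {i j k : ℕ} (hx : 1 ≤ i ∧ i ≤ m ∧ m + 1 ≤ j ∧ j ≤ m + n)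
    (hk : m + 1 ≤ k ∧ k ≤ m + n - 1) (hjk : k + 2 ≤ j ∨ j + 1 ≤ k) :
    Commute (mixedX m n i j) (mixedS m n k) := by
  rw [commute_iff_eq, ← inv_mul_eq_iff_eq_mul, ← mul_inv_eq_one, ← mul_assoc,
    mixedX_of_mem hx, mixedS_of_mem hk]
  exact PresentedGroup.one_of_mem (Or.inl (Or.inl (Or.inl (Or.inr
    ⟨i, j, k, ⟨⟨hx.1, hx.2.1, hx.2.2.1, hx.2.2.2, hk.1, hk.2⟩, hjk⟩, rfl⟩))))

theorem mixedX_succ {i j : ℕ} (hi : 1 ≤ i ∧ i ≤ m) (hj : m + 1 ≤ j ∧ j ≤ m + n - 1) :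
    mixedX m n i (j + 1) = mixedS m n j * mixedX m n i j * (mixedS m n j)⁻¹ := by
  rw [← mul_inv_eq_one, mixedX_of_mem ⟨hi.1, hi.2, by omega, by omega⟩,
    mixedX_of_mem ⟨hi.1, hi.2, hj.1, by omega⟩, mixedS_of_mem hj]
  exact PresentedGroup.one_of_mem (Or.inl (Or.inl (Or.inr
    ⟨i, j + 1, ⟨hi.1, hi.2, by omega, by omega⟩, rfl⟩)))

theorem commute_mixedX_mul {i j : ℕ} (hi : 1 ≤ i ∧ i ≤ m) (hj : m + 1 ≤ j ∧ j ≤ m + n - 1) :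
    Commute (mixedX m n i j) (mixedS m n j * mixedX m n i j * mixedS m n j) := by
  rw [← inv_conj_eq_iff_commute, ← mixedX_succ hi hj, ← mul_inv_eq_one,
    mixedX_of_mem ⟨hi.1, hi.2, hj.1, by omega⟩,
    mixedX_of_mem (j := j + 1) ⟨hi.1, hi.2, by omega, by omega⟩, mixedS_of_mem hj]
  exact PresentedGroup.one_of_mem (Or.inl (Or.inr ⟨i, j, ⟨hi.1, hi.2, hj.1, hj.2⟩, rfl⟩))

theorem commute_mixedX_mixedX_succ {i r j : ℕ} (hr : 1 ≤ r) (hri : r < i) (hi : i ≤ m)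
    (hj : m + 1 ≤ j ∧ j ≤ m + n - 1) :
    Commute (mixedX m n i j) (mixedX m n r (j + 1)) := by
  rw [commute_iff_eq, ← mul_inv_eq_one, mixedX_of_mem ⟨by omega, hi, hj.1, by omega⟩,
    mixedX_of_mem ⟨hr, by omega, by omega, by omega⟩]
  exact PresentedGroup.one_of_mem (Or.inr ⟨i, r, j, ⟨hr, hri, hi, hj.1, hj.2⟩, rfl⟩)

end Mixed

section Tietze

variable (m n : ℕ)

/-- Images of the generators `x_{ij}`, `s_k` in the irredundant presentation. -/
def mixedToIrrFun :
    {p : ℕ × ℕ // 1 ≤ p.1 ∧ p.1 ≤ m ∧ m + 1 ≤ p.2 ∧ p.2 ≤ m + n} ⊕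
      {k : ℕ // m + 1 ≤ k ∧ k ≤ m + n - 1} → PresentedGroup (irrRels m n) :=
  Sum.elim (fun p => conjTower (irrT m n) (irrY m n p.1.1) (p.1.2 - (m + 1)))
    (fun k => irrT m n (k.1 - m))

/-- Images of the generators `y_i`, `t_k` in the presentation on the `x_{ij}`, `s_k`. -/
def irrToMixedFun :
    {i : ℕ // 1 ≤ i ∧ i ≤ m} ⊕ {k : ℕ // 1 ≤ k ∧ k ≤ n - 1} → PresentedGroup (mixedRels m n) :=
  Sum.elim (fun i => mixedX m n i.1 (m + 1)) (fun k => mixedS m n (m + k.1))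

theorem lift_mixedToIrrFun_eq_one :
    ∀ r ∈ mixedRels m n, FreeGroup.lift (mixedToIrrFun m n) r = 1 := by
  have hX : ∀ i j h, FreeGroup.lift (mixedToIrrFun m n) (of (Sum.inl ⟨(i, j), h⟩)) =
      conjTower (irrT m n) (irrY m n i) (j - (m + 1)) := fun _ _ _ => FreeGroup.lift_apply_of
  have hS : ∀ k h, FreeGroup.lift (mixedToIrrFun m n) (of (Sum.inr ⟨k, h⟩)) =
      irrT m n (k - m) := fun _ _ => FreeGroup.lift_apply_of
  have hc := @commute_irrT m n
  have hb := @irrT_braid m n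
  have hy := @commute_irrY_irrT m n
  rintro _ (((((⟨⟨k, hk⟩, ⟨l, hl⟩, hkl, rfl⟩ | ⟨k, hk, rfl⟩) | ⟨i, j, k, h, rfl⟩) |
    ⟨i, j, h, rfl⟩) | ⟨i, j, h, rfl⟩) | ⟨i, r, j, h, rfl⟩)
  · delta MixedIdx
    simp only [_root_.map_mul, _root_.map_inv, hS]
    rw [← commutatorElement_def, commutatorElement_eq_one_iff_commute]
    change k + 1 < l ∨ l + 1 < k at hkl
    rcases hkl with hkl | hkl
    · exact hc _ _ (by omega) (by omega) (by omega)
    · exact (hc _ _ (by omega) (by omega) (by omega)).symm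
  · delta MixedIdx
    simp only [_root_.map_mul, _root_.map_inv, hS]
    rw [mul_inv_eq_one, show k + 1 - m = k - m + 1 by omega]
    exact hb _ (by omega) (by omega)
  · delta MixedIdx
    simp only [_root_.map_mul, _root_.map_inv, hX, hS]
    rw [mul_inv_eq_one, mul_assoc, inv_mul_eq_iff_eq_mul]
    have hi : 1 ≤ i ∧ i ≤ m := by omega
    rcases h.2 with hjk | hjk
    · exact commute_conjTower_of_gt hc hb (hy hi) (by omega) (by omega) (by omega)
    · exact commute_conjTower_of_lt hc (hy hi) (by omega) (by omega)
  · obtain ⟨p, rfl⟩ : ∃ p, j = m + 1 + p + 1 := ⟨j - (m + 2), by omega⟩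
    delta MixedIdx
    simp only [_root_.map_mul, _root_.map_inv, hX, hS]
    rw [mul_inv_eq_one, show m + 1 + p + 1 - (m + 1) = p + 1 by omega,
      show m + 1 + p + 1 - 1 - m = p + 1 by omega,
      show m + 1 + p + 1 - 1 - (m + 1) = p by omega, conjTower_succ]
  · obtain ⟨p, rfl⟩ : ∃ p, j = m + 1 + p := ⟨j - (m + 1), by omega⟩
    delta MixedIdx
    simp only [_root_.map_mul, _root_.map_inv, hX, hS]
    have hi : 1 ≤ i ∧ i ≤ m := by omega
    rw [mul_inv_eq_one, show m + 1 + p + 1 - (m + 1) = p + 1 by omega,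
      show m + 1 + p - m = p + 1 by omega, show m + 1 + p - (m + 1) = p by omega, conjTower_succ,
      inv_conj_eq_iff_commute]
    exact commute_conjTower_mul_conjTower_mul hc hb (hy hi) (commute_irrY_mul hi) (by omega)
  · obtain ⟨p, rfl⟩ : ∃ p, j = m + 1 + p := ⟨j - (m + 1), by omega⟩
    delta MixedIdx
    simp only [_root_.map_mul, _root_.map_inv, hX]
    rw [mul_inv_eq_one, show m + 1 + p + 1 - (m + 1) = p + 1 by omega,
      show m + 1 + p - (m + 1) = p by omega]
    exact commute_conjTower_conjTower_succ hc hb (hy (by omega)) (hy (by omega))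
      (commute_irrY_conj h.1 h.2.1 h.2.2.1) (by omega)

theorem lift_irrToMixedFun_eq_one :
    ∀ r ∈ irrRels m n, FreeGroup.lift (irrToMixedFun m n) r = 1 := by
  have hX : ∀ i h, FreeGroup.lift (irrToMixedFun m n) (of (Sum.inl ⟨i, h⟩)) =
      mixedX m n i (m + 1) := fun _ _ => FreeGroup.lift_apply_of
  have hS : ∀ k h, FreeGroup.lift (irrToMixedFun m n) (of (Sum.inr ⟨k, h⟩)) =
      mixedS m n (m + k) := fun _ _ => FreeGroup.lift_apply_of
  rintro _ ((((⟨⟨k, hk⟩, ⟨l, hl⟩, hkl, rfl⟩ | ⟨k, hk, rfl⟩) | ⟨i, k, h, rfl⟩) |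
    ⟨i, h, rfl⟩) | ⟨i, r, h, rfl⟩)
  · delta IrrIdx
    simp only [_root_.map_mul, _root_.map_inv, hS]
    rw [← commutatorElement_def, commutatorElement_eq_one_iff_commute]
    change k + 1 < l ∨ l + 1 < k at hkl
    exact commute_mixedS (by omega) (by omega) (by omega)
  · delta IrrIdx
    simp only [_root_.map_mul, _root_.map_inv, hS]
    rw [mul_inv_eq_one]
    exact mixedS_braid (by omega) (by omega)
  · delta IrrIdx
    simp only [_root_.map_mul, _root_.map_inv, hX, hS]
    rw [mul_inv_eq_one]
    exact commute_mixedX_mixedS (by omega) (by omega) (by omega)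
  · delta IrrIdx
    simp only [_root_.map_mul, _root_.map_inv, hX, hS]
    rw [mul_inv_eq_one, mul_assoc, mul_assoc, ← mul_assoc (mixedS m n (m + 1))]
    exact commute_mixedX_mul (by omega) (by omega)
  · delta IrrIdx
    simp only [_root_.map_mul, _root_.map_inv, hX, hS]
    rw [mul_inv_eq_one, ← mixedX_succ (by omega) (by omega)]
    exact commute_mixedX_mixedX_succ h.1 h.2.1 h.2.2.1 (by omega)

/-- The homomorphism `x_{i,m+1+p} ↦ t_p ⋯ t_1 y_i t_1⁻¹ ⋯ t_p⁻¹`, `s_{m+k} ↦ t_k`. -/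
def mixedToIrr : PresentedGroup (mixedRels m n) →* PresentedGroup (irrRels m n) :=
  PresentedGroup.toGroup (lift_mixedToIrrFun_eq_one m n)

/-- The homomorphism `y_i ↦ x_{i,m+1}`, `t_k ↦ s_{m+k}`. -/
def irrToMixed : PresentedGroup (irrRels m n) →* PresentedGroup (mixedRels m n) :=
  PresentedGroup.toGroup (lift_irrToMixedFun_eq_one m n)

variable {m n}

theorem mixedToIrr_mixedX {i j : ℕ} (h : 1 ≤ i ∧ i ≤ m ∧ m + 1 ≤ j ∧ j ≤ m + n) :
    mixedToIrr m n (mixedX m n i j) = conjTower (irrT m n) (irrY m n i) (j - (m + 1)) := by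
  rw [mixedX_of_mem h]
  exact PresentedGroup.toGroup.of _

theorem mixedToIrr_mixedS {k : ℕ} (h : m + 1 ≤ k ∧ k ≤ m + n - 1) :
    mixedToIrr m n (mixedS m n k) = irrT m n (k - m) := by
  rw [mixedS_of_mem h]
  exact PresentedGroup.toGroup.of _

theorem irrToMixed_irrY {i : ℕ} (h : 1 ≤ i ∧ i ≤ m) :
    irrToMixed m n (irrY m n i) = mixedX m n i (m + 1) := by
  rw [irrY_of_mem h]
  exact PresentedGroup.toGroup.of _

theorem irrToMixed_irrT {k : ℕ} (h : 1 ≤ k ∧ k ≤ n - 1) :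
    irrToMixed m n (irrT m n k) = mixedS m n (m + k) := by
  rw [irrT_of_mem h]
  exact PresentedGroup.toGroup.of _

theorem irrToMixed_conjTower {i p : ℕ} (hi : 1 ≤ i ∧ i ≤ m) (hp : p + 1 ≤ n) :
    irrToMixed m n (conjTower (irrT m n) (irrY m n i) p) = mixedX m n i (m + 1 + p) := by
  induction p with
  | zero => exact irrToMixed_irrY hi
  | succ p ih =>
    rw [conjTower_succ, _root_.map_mul, _root_.map_mul, _root_.map_inv, ih (by omega),
      irrToMixed_irrT (by omega), ← add_assoc (m + 1), mixedX_succ hi (by omega),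
      add_right_comm m 1 p, add_assoc m p 1]

theorem irrToMixed_comp_mixedToIrr :
    (irrToMixed m n).comp (mixedToIrr m n) = MonoidHom.id _ := by
  refine PresentedGroup.ext ?_
  rintro (⟨⟨i, j⟩, h⟩ | ⟨k, h⟩)
  · change irrToMixed m n (mixedToIrr m n (PresentedGroup.mk _ (of (Sum.inl ⟨(i, j), h⟩)))) =
      PresentedGroup.mk _ (of (Sum.inl ⟨(i, j), h⟩))
    dsimp only at h
    rw [← mixedX_of_mem h, mixedToIrr_mixedX h, irrToMixed_conjTower (by omega) (by omega),
      Nat.add_sub_cancel' h.2.2.1]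
    exact mixedX_of_mem h
  · change irrToMixed m n (mixedToIrr m n (PresentedGroup.mk _ (of (Sum.inr ⟨k, h⟩)))) =
      PresentedGroup.mk _ (of (Sum.inr ⟨k, h⟩))
    rw [← mixedS_of_mem h, mixedToIrr_mixedS h, irrToMixed_irrT (by omega),
      Nat.add_sub_cancel' (by omega)]
    exact mixedS_of_mem h

theorem mixedToIrr_comp_irrToMixed (hn : 1 ≤ n) :
    (mixedToIrr m n).comp (irrToMixed m n) = MonoidHom.id _ := by
  refine PresentedGroup.ext ?_
  rintro (⟨i, h⟩ | ⟨k, h⟩)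
  · change mixedToIrr m n (irrToMixed m n (PresentedGroup.mk _ (of (Sum.inl ⟨i, h⟩)))) =
      PresentedGroup.mk _ (of (Sum.inl ⟨i, h⟩))
    rw [← irrY_of_mem h, irrToMixed_irrY h, mixedToIrr_mixedX (by omega), Nat.sub_self]
    exact irrY_of_mem h
  · change mixedToIrr m n (irrToMixed m n (PresentedGroup.mk _ (of (Sum.inr ⟨k, h⟩)))) =
      PresentedGroup.mk _ (of (Sum.inr ⟨k, h⟩))
    rw [← irrT_of_mem h, irrToMixed_irrT h, mixedToIrr_mixedS (by omega), Nat.add_sub_cancel_left]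
    exact irrT_of_mem h

end Tietze

/-- Tietze equivalence of the two presentations of `B_{m,n}`: the presented groups of
Theorem 2 and Theorem 3 are isomorphic, via `x_{i,m+1} ↦ y_i` and `s_{m+k} ↦ t_k`. -/
theorem statement18 (m n : ℕ) (hm : 1 ≤ m) (hn : 1 ≤ n) :
    ∃ φ : PresentedGroup (mixedRels m n) ≃* PresentedGroup (irrRels m n),
      (∀ i : ℕ, ∀ h : 1 ≤ i ∧ i ≤ m,
        φ (PresentedGroup.of (Sum.inl ⟨(i, m + 1), by omega⟩)) =
          PresentedGroup.of (Sum.inl ⟨i, h⟩)) ∧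
      (∀ k : ℕ, ∀ h : 1 ≤ k ∧ k ≤ n - 1,
        φ (PresentedGroup.of (Sum.inr ⟨m + k, by omega⟩)) =
          PresentedGroup.of (Sum.inr ⟨k, h⟩)) := by
  refine ⟨(mixedToIrr m n).toMulEquiv (irrToMixed m n) irrToMixed_comp_mixedToIrr
    (mixedToIrr_comp_irrToMixed hn), fun i h => ?_, fun k h => ?_⟩
  · have hx := mixedToIrr_mixedX (m := m) (n := n) (i := i) (j := m + 1) (by omega)
    rw [Nat.sub_self, mixedX_of_mem (by omega)] at hx
    exact hx.trans (irrY_of_mem h)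
  · have hs := mixedToIrr_mixedS (m := m) (n := n) (k := m + k) (by omega)
    rw [Nat.add_sub_cancel_left, mixedS_of_mem (by omega)] at hs
    exact hs.trans (irrT_of_mem h)

end BraidPaper
end

section
/- (P_{1,n} = P_{1+n}) For m = 1, the subgroup P_{1,n} of B_{1+n} equals the full pure braid group P_{1+n}; equivalently, the kernel of π : B_{1+n} → Equiv.Perm (Fin (1+n)) is contained in the subgroup B_{1,n} of B_{1+n}. -/
open FreeGroup

namespace BraidPaper

section Coset

variable {G : Type*} [Group G]

/-- The ascending product `s_1 s_2 ⋯ s_k`. -/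
def ascProd (s : ℕ → G) : ℕ → G
  | 0 => 1
  | k + 1 => ascProd s k * s (k + 1)

/-- The braid and far commutation relations for `s_1, …, s_N`. -/
structure IsBraidFamily (s : ℕ → G) (N : ℕ) : Prop where
  comm : ∀ k l, 1 ≤ k → k + 2 ≤ l → l ≤ N → s k * s l = s l * s k
  braid : ∀ k, 1 ≤ k → k + 1 ≤ N → s k * s (k + 1) * s k = s (k + 1) * s k * s (k + 1)

namespace IsBraidFamily

variable {s : ℕ → G} {N : ℕ}

theorem ascProd_mul_of_lt (hs : IsBraidFamily s N) {k l : ℕ} (hkl : k + 2 ≤ l) (hl : l ≤ N) :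
    ascProd s k * s l = s l * ascProd s k := by
  induction k with
  | zero => simp [ascProd]
  | succ k ih =>
    rw [ascProd, mul_assoc, hs.comm (k + 1) l (by omega) (by omega) hl, ← mul_assoc,
      ih (by omega), mul_assoc]

theorem ascProd_mul_of_gt (hs : IsBraidFamily s N) {k l : ℕ} (hl : 1 ≤ l) (hlk : l < k)
    (hk : k ≤ N) : ascProd s k * s l = s (l + 1) * ascProd s k := by
  induction k, hlk using Nat.le_induction with
  | base =>
    obtain ⟨m, rfl⟩ := Nat.exists_eq_add_of_le' hl
    have hcomm := hs.ascProd_mul_of_lt (k := m) (l := m + 1 + 1) le_rfl (by omega)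
    calc ascProd s (m + 1 + 1) * s (m + 1)
        = ascProd s m * (s (m + 1) * s (m + 1 + 1) * s (m + 1)) := by
          simp only [ascProd, mul_assoc]
      _ = ascProd s m * s (m + 1 + 1) * (s (m + 1) * s (m + 1 + 1)) := by
          rw [hs.braid (m + 1) (by omega) (by omega)]; simp only [mul_assoc]
      _ = s (m + 1 + 1) * ascProd s (m + 1 + 1) := by
          rw [hcomm]; simp only [ascProd, mul_assoc]
  | succ k hlk ih =>
    rw [ascProd, mul_assoc, ← hs.comm l (k + 1) hl (by omega) hk, ← mul_assoc,
      ih (by omega), mul_assoc]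

theorem conj_sq_mem (hs : IsBraidFamily s N) {H : Subgroup G} (hsq : s 1 ^ 2 ∈ H)
    (hH : ∀ k, 2 ≤ k → k ≤ N → s k ∈ H) {k : ℕ} (hk : k + 1 ≤ N) :
    ascProd s k * s (k + 1) ^ 2 * (ascProd s k)⁻¹ ∈ H := by
  induction k with
  | zero => simpa [ascProd] using hsq
  | succ k ih =>
    have hconj : s (k + 1) * s (k + 1 + 1) ^ 2 * (s (k + 1))⁻¹ =
        (s (k + 1 + 1))⁻¹ * s (k + 1) ^ 2 * s (k + 1 + 1) := by
      have hb := hs.braid (k + 1) (by omega) hk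
      rw [mul_inv_eq_iff_eq_mul]
      apply mul_left_cancel (a := s (k + 1 + 1))
      calc s (k + 1 + 1) * (s (k + 1) * s (k + 1 + 1) ^ 2)
          = s (k + 1 + 1) * s (k + 1) * s (k + 1 + 1) * s (k + 1 + 1) := by
            simp only [pow_two, mul_assoc]
        _ = s (k + 1) * (s (k + 1 + 1) * s (k + 1) * s (k + 1 + 1)) := by
            nth_rewrite 1 [← hb]; simp only [mul_assoc]
        _ = s (k + 1 + 1) * ((s (k + 1 + 1))⁻¹ * s (k + 1) ^ 2 * s (k + 1 + 1) * s (k + 1)) := by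
            rw [← hb]; simp [pow_two, mul_assoc]
    have hcomm := hs.ascProd_mul_of_lt (k := k) (l := k + 1 + 1) le_rfl hk
    have hinv : ascProd s k * (s (k + 1 + 1))⁻¹ = (s (k + 1 + 1))⁻¹ * ascProd s k := by
      rw [mul_inv_eq_iff_eq_mul, mul_assoc, hcomm, inv_mul_cancel_left]
    have hinv' : s (k + 1 + 1) * (ascProd s k)⁻¹ = (ascProd s k)⁻¹ * s (k + 1 + 1) := by
      rw [mul_inv_eq_iff_eq_mul, mul_assoc, ← hcomm, inv_mul_cancel_left]
    have heq : ascProd s (k + 1) * s (k + 1 + 1) ^ 2 * (ascProd s (k + 1))⁻¹ =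
        (s (k + 1 + 1))⁻¹ * (ascProd s k * s (k + 1) ^ 2 * (ascProd s k)⁻¹) * s (k + 1 + 1) :=
      calc _ = ascProd s k * (s (k + 1) * s (k + 1 + 1) ^ 2 * (s (k + 1))⁻¹) *
            (ascProd s k)⁻¹ := by simp only [ascProd, mul_inv_rev, mul_assoc]
        _ = ascProd s k * (s (k + 1 + 1))⁻¹ * s (k + 1) ^ 2 *
            (s (k + 1 + 1) * (ascProd s k)⁻¹) := by rw [hconj]; simp only [mul_assoc]
        _ = _ := by rw [hinv, hinv']; simp only [mul_assoc]
    rw [heq]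
    have hmem := hH (k + 1 + 1) (by omega) hk
    exact H.mul_mem (H.mul_mem (H.inv_mem hmem) (ih (by omega))) hmem

/-- The products `s_1 ⋯ s_k` represent all right cosets of a subgroup containing `s_1²` and
`s_2, …, s_N`. -/
theorem exists_mem_mul_ascProd (hs : IsBraidFamily s N) {H : Subgroup G} (hsq : s 1 ^ 2 ∈ H)
    (hH : ∀ k, 2 ≤ k → k ≤ N → s k ∈ H) {x : G}
    (hx : x ∈ Subgroup.closure {y | ∃ l, 1 ≤ l ∧ l ≤ N ∧ y = s l}) :
    ∃ h ∈ H, ∃ k ≤ N, x = h * ascProd s k := by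
  have key : ∀ k ≤ N, ∀ l, 1 ≤ l → l ≤ N →
      (∃ h ∈ H, ∃ k' ≤ N, ascProd s k * s l = h * ascProd s k') ∧
      (∃ h ∈ H, ∃ k' ≤ N, ascProd s k * (s l)⁻¹ = h * ascProd s k') := by
    intro k hk l hl hlN
    have of_comm : ∀ m, 2 ≤ m → m ≤ N → ascProd s k * s l = s m * ascProd s k →
        (∃ h ∈ H, ∃ k' ≤ N, ascProd s k * s l = h * ascProd s k') ∧
        (∃ h ∈ H, ∃ k' ≤ N, ascProd s k * (s l)⁻¹ = h * ascProd s k') := by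
      intro m hm hmN h
      refine ⟨⟨_, hH m hm hmN, k, hk, h⟩, _, H.inv_mem (hH m hm hmN), k, hk, ?_⟩
      rw [mul_inv_eq_iff_eq_mul, mul_assoc, h, inv_mul_cancel_left]
    rcases lt_trichotomy l k with h | rfl | h
    · exact of_comm (l + 1) (by omega) (by omega) (hs.ascProd_mul_of_gt hl h hk)
    · obtain ⟨m, rfl⟩ := Nat.exists_eq_add_of_le' hl
      refine ⟨⟨_, hs.conj_sq_mem hsq hH hlN, m, by omega, ?_⟩, 1, H.one_mem, m, by omega, ?_⟩
      · simp [ascProd, pow_two, mul_assoc]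
      · simp [ascProd]
    · rcases (Nat.succ_le_of_lt h).eq_or_lt with rfl | h'
      · refine ⟨⟨1, H.one_mem, k + 1, hlN, by simp [ascProd]⟩,
          _, H.inv_mem (hs.conj_sq_mem hsq hH hlN), k + 1, hlN, ?_⟩
        simp [ascProd, pow_two, mul_assoc]
      · exact of_comm l (by omega) hlN (hs.ascProd_mul_of_lt h' hlN)
  induction hx using Subgroup.closure_induction_right with
  | one => exact ⟨1, H.one_mem, 0, Nat.zero_le _, by simp [ascProd]⟩
  | mul_right x _ y hy ih =>
    obtain ⟨h, hh, k, hk, rfl⟩ := ih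
    obtain ⟨l, hl, hlN, rfl⟩ := hy
    obtain ⟨h', hh', k', hk', e⟩ := (key k hk l hl hlN).1
    exact ⟨h * h', H.mul_mem hh hh', k', hk', by rw [mul_assoc, e, mul_assoc]⟩
  | mul_inv_cancel x _ y hy ih =>
    obtain ⟨h, hh, k, hk, rfl⟩ := ih
    obtain ⟨l, hl, hlN, rfl⟩ := hy
    obtain ⟨h', hh', k', hk', e⟩ := (key k hk l hl hlN).2
    exact ⟨h * h', H.mul_mem hh hh', k', hk', by rw [mul_assoc, e, mul_assoc]⟩

end IsBraidFamily

end Coset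

theorem isBraidFamily_sgen (N : ℕ) : IsBraidFamily (sgen N) N where
  comm k l hk hkl hl := by
    have h := PresentedGroup.one_of_mem (rels := braidRels N)
      (Or.inl ⟨⟨k - 1, by omega⟩, ⟨l - 1, by omega⟩, Or.inl (by simp; omega), rfl⟩)
    simp only [_root_.map_mul, _root_.map_inv] at h
    rw [mul_inv_eq_one, mul_inv_eq_iff_eq_mul] at h
    simp only [sgen, dif_pos (show 1 ≤ k ∧ k ≤ N by omega),
      dif_pos (show 1 ≤ l ∧ l ≤ N by omega)]
    exact h
  braid k hk hkN := by
    have h := PresentedGroup.one_of_mem (rels := braidRels N)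
      (Or.inr ⟨⟨k - 1, by omega⟩, ⟨k + 1 - 1, by omega⟩, by simp; omega, rfl⟩)
    simp only [_root_.map_mul, _root_.map_inv] at h
    rw [mul_inv_eq_one, mul_inv_eq_iff_eq_mul, mul_inv_eq_iff_eq_mul] at h
    simp only [sgen, dif_pos (show 1 ≤ k ∧ k ≤ N by omega),
      dif_pos (show 1 ≤ k + 1 ∧ k + 1 ≤ N by omega)]
    exact h

theorem mem_closure_sgen {N : ℕ} (x : BraidGroup N) :
    x ∈ Subgroup.closure {y | ∃ l, 1 ≤ l ∧ l ≤ N ∧ y = sgen N l} := by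
  have h : x ∈ Subgroup.closure (Set.range (PresentedGroup.of (rels := braidRels N))) := by
    rw [PresentedGroup.closure_range_of]; trivial
  refine Subgroup.closure_mono ?_ h
  rintro _ ⟨⟨i, hi⟩, rfl⟩
  exact ⟨i + 1, by omega, by omega, by simp [sgen, hi]⟩

theorem sgen_sq_mem_Bmn {n : ℕ} (hn : 1 ≤ n) : sgen (1 + n - 1) 1 ^ 2 ∈ Bmn 1 n :=
  Subgroup.subset_closure
    (Or.inl ⟨1, 2, le_rfl, by omega, by omega, by omega, by simp [agen, dprod]⟩)

theorem sgen_mem_Bmn {m n k : ℕ} (hk : m + 1 ≤ k) (hkn : k ≤ m + n - 1) :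
    sgen (m + n - 1) k ∈ Bmn m n :=
  Subgroup.subset_closure (Or.inr ⟨k, hk, hkn, rfl⟩)

theorem map_apply_zero_of_mem_Bmn {n : ℕ}
    {π : BraidGroup (1 + n - 1) →* Equiv.Perm (Fin (1 + n))}
    (hπ : ∀ k : ℕ, ∀ _hk1 : 1 ≤ k, ∀ _hk2 : k ≤ 1 + n - 1,
      π (sgen (1 + n - 1) k) =
        Equiv.swap (⟨k - 1, by omega⟩ : Fin (1 + n)) (⟨k, by omega⟩ : Fin (1 + n)))
    {h : BraidGroup (1 + n - 1)} (hh : h ∈ Bmn 1 n) :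
    π h ⟨0, by omega⟩ = ⟨0, by omega⟩ := by
  suffices Bmn 1 n ≤ (MulAction.stabilizer (Equiv.Perm (Fin (1 + n)))
      (⟨0, by omega⟩ : Fin (1 + n))).comap π from this hh
  refine (Subgroup.closure_le _).2 ?_
  rintro _ (⟨i, j, hi, hij, -, hj, rfl⟩ | ⟨k, hk, hkn, rfl⟩)
  · have h1 : π (agen (1 + n - 1) i j) = 1 := by
      simp [agen, hπ i hi (by omega), pow_two]
    simp [h1]
  · change π _ _ = _
    rw [hπ k (by omega) hkn]
    apply Equiv.swap_apply_of_ne_of_ne <;> simp [Fin.ext_iff] <;> omega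

theorem map_ascProd_sgen_apply {n : ℕ}
    {π : BraidGroup (1 + n - 1) →* Equiv.Perm (Fin (1 + n))}
    (hπ : ∀ k : ℕ, ∀ _hk1 : 1 ≤ k, ∀ _hk2 : k ≤ 1 + n - 1,
      π (sgen (1 + n - 1) k) =
        Equiv.swap (⟨k - 1, by omega⟩ : Fin (1 + n)) (⟨k, by omega⟩ : Fin (1 + n)))
    {k : ℕ} (hk : k ≤ 1 + n - 1) :
    π (ascProd (sgen (1 + n - 1)) k) ⟨k, by omega⟩ = ⟨0, by omega⟩ := by
  induction k with
  | zero => simp [ascProd]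
  | succ k ih =>
    rw [ascProd, _root_.map_mul, Equiv.Perm.mul_apply, hπ (k + 1) (by omega) hk, Equiv.swap_apply_right]
    exact ih (by omega)

/-- For `m = 1`, `P_{1,n} = P_{1+n}`: the subgroup `B_{1,n} ⊓ ker π` of `B_{1+n}` is the
full pure braid group `ker π`; equivalently `ker π ≤ B_{1,n}`. -/
theorem statement19 (n : ℕ) (hn : 1 ≤ n)
    (π : BraidGroup (1 + n - 1) →* Equiv.Perm (Fin (1 + n)))
    (hπ : ∀ k : ℕ, ∀ _hk1 : 1 ≤ k, ∀ _hk2 : k ≤ 1 + n - 1,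
      π (sgen (1 + n - 1) k) =
        Equiv.swap (⟨k - 1, by omega⟩ : Fin (1 + n)) (⟨k, by omega⟩ : Fin (1 + n))) :
    Bmn 1 n ⊓ π.ker = π.ker := by
  refine inf_eq_right.2 fun x hx => ?_
  obtain ⟨h, hh, k, hk, rfl⟩ := (isBraidFamily_sgen (1 + n - 1)).exists_mem_mul_ascProd
    (sgen_sq_mem_Bmn hn) (fun k hk hkn => sgen_mem_Bmn hk hkn) (mem_closure_sgen x)
  have hfix : π (h * ascProd (sgen (1 + n - 1)) k) ⟨k, by omega⟩ = ⟨k, by omega⟩ := by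
    rw [MonoidHom.mem_ker.1 hx, Equiv.Perm.one_apply]
  rw [_root_.map_mul, Equiv.Perm.mul_apply, map_ascProd_sgen_apply hπ hk,
    map_apply_zero_of_mem_Bmn hπ hh] at hfix
  obtain rfl : 0 = k := congrArg Fin.val hfix
  simpa [ascProd] using hh

end BraidPaper
end
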